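/- Suppose f : Ω × ℝ^d × ℝ^m × ℝ^(d×N) → [0,∞) is convex-quasiconvex in the last two variables and satisfies the growth condition (H1)_p. Then its recession function f_p^∞(x,u,b,ξ) := limsup_{t→∞} f(x,u,t^{1/p} b, t ξ)/t is convex-quasiconvex in (b,ξ) for each fixed (x,u). -/

import Mathlib

open MeasureTheory

/-- Convex-quasiconvexity of `f : ℝ^m × ℝ^(d×N) → ℝ` (gradients are encoded as
continuous linear maps `ℝ^N →L ℝ^d`): the averaged Jensen-type inequality over every
bounded open set `D`, tested with zero-average `L^∞` perturbations `η` of `b` and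
gradients of Lipschitz maps vanishing outside `D` (i.e. `W_0^{1,∞}(D)`). -/
def ConvexQuasiconvex (N d m : ℕ)
    (f : EuclideanSpace ℝ (Fin m) →
      (EuclideanSpace ℝ (Fin N) →L[ℝ] EuclideanSpace ℝ (Fin d)) → ℝ) : Prop :=
  ∀ (b : EuclideanSpace ℝ (Fin m))
    (ξ : EuclideanSpace ℝ (Fin N) →L[ℝ] EuclideanSpace ℝ (Fin d))
    (D : Set (EuclideanSpace ℝ (Fin N))),
    IsOpen D → Bornology.IsBounded D → D.Nonempty →
    ∀ η : EuclideanSpace ℝ (Fin N) → EuclideanSpace ℝ (Fin m),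
      Measurable η → (∃ M, ∀ x, ‖η x‖ ≤ M) → (∫ x in D, η x) = 0 →
      ∀ (φ : EuclideanSpace ℝ (Fin N) → EuclideanSpace ℝ (Fin d)) (L : NNReal),
        LipschitzWith L φ → (∀ x ∉ D, φ x = 0) →
        f b ξ ≤ (volume D).toReal⁻¹ * ∫ x in D, f (b + η x) (ξ + fderiv ℝ φ x)


open Filter

/-- The (p,1)-recession function of `f`, defined as a pointwise limsup. -/
noncomputable def recP {N d m : ℕ} (p : ℝ)
    (f : EuclideanSpace ℝ (Fin N) → EuclideanSpace ℝ (Fin d) →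
      EuclideanSpace ℝ (Fin m) →
      (EuclideanSpace ℝ (Fin N) →L[ℝ] EuclideanSpace ℝ (Fin d)) → ℝ)
    (x : EuclideanSpace ℝ (Fin N)) (u : EuclideanSpace ℝ (Fin d))
    (b : EuclideanSpace ℝ (Fin m))
    (ξ : EuclideanSpace ℝ (Fin N) →L[ℝ] EuclideanSpace ℝ (Fin d)) : ℝ :=
  limsup (fun t : ℝ => f x u ((t ^ (1 / p)) • b) (t • ξ) / t) atTop

open Classical in
lemma aux_setIntegral_piecewise {X E : Type*} [MeasurableSpace X] [NormedAddCommGroup E]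
    [NormedSpace ℝ E] [CompleteSpace E] (μ : Measure X) (B D : Set X) (hBD : B ⊆ D)
    (hB : MeasurableSet B) (hμ : μ D ≠ ⊤) (a c : E) :
    ∫ x in D, B.piecewise (fun _ => a) (fun _ => c) x ∂μ
      = (μ.real B) • a + (μ.real D - μ.real B) • c := by
  have : IsFiniteMeasure (μ.restrict D) := ⟨by simpa using lt_top_iff_ne_top.2 hμ⟩
  rw [integral_piecewise hB (integrable_const a).integrableOn (integrable_const c).integrableOn]
  rw [Measure.restrict_restrict hB, Measure.restrict_restrict hB.compl]
  rw [setIntegral_const, setIntegral_const, Set.inter_eq_left.2 hBD]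
  have : Bᶜ ∩ D = D \ B := by ext; simp [and_comm]
  rw [this, measureReal_sdiff hBD hB hμ]

lemma aux_scale {N d m : ℕ} (g : EuclideanSpace ℝ (Fin m) →
      (EuclideanSpace ℝ (Fin N) →L[ℝ] EuclideanSpace ℝ (Fin d)) → ℝ)
    (hg : ConvexQuasiconvex N d m g) (s t : ℝ) (ht : 0 < t) :
    ConvexQuasiconvex N d m (fun b ξ => g (s • b) (t • ξ) / t) := by
  intro b ξ D hD hDb hDn η hη hηb hη0 φ L hφ hφ0
  obtain ⟨M, hM⟩ := hηb
  have h := hg (s • b) (t • ξ) D hD hDb hDn (fun x => s • η x) (hη.const_smul s)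
    ⟨|s| * M, fun x => by
      rw [norm_smul, Real.norm_eq_abs]; exact mul_le_mul_of_nonneg_left (hM x) (abs_nonneg s)⟩
    (by rw [integral_smul, hη0, smul_zero]) (t • φ) (‖t‖₊ * L)
    (LipschitzWith.of_dist_le_mul fun x y => by
      have := hφ.dist_le_mul x y
      simp only [Pi.smul_apply, dist_smul₀, NNReal.coe_mul, coe_nnnorm]
      nlinarith [norm_nonneg t])
    (fun x hx => by simp [hφ0 x hx])
  simp only [fderiv_const_smul_field, Pi.smul_apply] at h
  simp only [div_eq_mul_inv, smul_add]
  rw [integral_mul_const, ← mul_assoc]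
  exact mul_le_mul_of_nonneg_right h (inv_nonneg.2 ht.le)

/-- modulus of continuity property -/
def AuxMod (N d m : ℕ) (p C : ℝ) (g : EuclideanSpace ℝ (Fin m) →
      (EuclideanSpace ℝ (Fin N) →L[ℝ] EuclideanSpace ℝ (Fin d)) → ℝ) : Prop :=
  ∀ b ξ b' ξ' δ, 0 < δ → δ ≤ 1 / 2 → ‖b' - b‖ ≤ δ → ‖ξ' - ξ‖ ≤ δ →
    g b ξ ≤ g b' ξ' + N * δ * (C * (1 + (‖b‖ + 1) ^ p +
      (‖ξ‖ + lipschitzExtensionConstant (EuclideanSpace ℝ (Fin d)))))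

lemma aux_test {N d : ℕ} (A : EuclideanSpace ℝ (Fin N) →L[ℝ] EuclideanSpace ℝ (Fin d))
    (δ : ℝ) (hδ : 0 < δ) (hδ1 : δ ≤ 1 / 2) (hA : ‖A‖ ≤ δ) :
    ∃ φ : EuclideanSpace ℝ (Fin N) → EuclideanSpace ℝ (Fin d),
      LipschitzWith (lipschitzExtensionConstant (EuclideanSpace ℝ (Fin d))) φ ∧
      (∀ x ∉ Metric.ball (0 : EuclideanSpace ℝ (Fin N)) 1, φ x = 0) ∧
      ∀ x ∈ Metric.ball (0 : EuclideanSpace ℝ (Fin N)) (1 - δ), fderiv ℝ φ x = A := by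
  classical
  set B := Metric.ball (0 : EuclideanSpace ℝ (Fin N)) (1 - δ) with hB
  set D := Metric.ball (0 : EuclideanSpace ℝ (Fin N)) 1 with hD
  have key : ∀ x ∈ B, ∀ y ∈ Dᶜ, ‖A x‖ ≤ ‖x - y‖ := by
    intro x hx y hy
    simp only [hB, hD, Metric.mem_ball, dist_zero_right, Set.mem_compl_iff, not_lt] at hx hy
    have h1 : ‖A x‖ ≤ δ * 1 := (A.le_opNorm x).trans
      (mul_le_mul hA (by linarith) (norm_nonneg _) hδ.le)
    have h2 := norm_sub_norm_le y x
    rw [norm_sub_rev] at h2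
    linarith
  have hBD : ∀ y ∈ Dᶜ, y ∉ B := by
    intro y hy hy'
    simp only [hB, hD, Metric.mem_ball, dist_zero_right, Set.mem_compl_iff, not_lt] at hy hy'
    linarith
  have hl : LipschitzOnWith 1 (B.piecewise (fun x => A x) (fun _ => 0)) (B ∪ Dᶜ) := by
    apply LipschitzOnWith.of_dist_le_mul
    intro x hx y hy
    rw [NNReal.coe_one, one_mul, dist_eq_norm, dist_eq_norm]
    rcases hx with hx | hx <;> rcases hy with hy | hy
    · rw [Set.piecewise_eq_of_mem _ _ _ hx, Set.piecewise_eq_of_mem _ _ _ hy, ← map_sub]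
      refine (A.le_opNorm _).trans ?_
      nlinarith [norm_nonneg (x - y)]
    · rw [Set.piecewise_eq_of_mem _ _ _ hx, Set.piecewise_eq_of_notMem _ _ _ (hBD y hy), sub_zero]
      exact key x hx y hy
    · rw [Set.piecewise_eq_of_mem _ _ _ hy, Set.piecewise_eq_of_notMem _ _ _ (hBD x hx), zero_sub,
        norm_neg, norm_sub_rev]
      exact key y hy x hx
    · rw [Set.piecewise_eq_of_notMem _ _ _ (hBD x hx), Set.piecewise_eq_of_notMem _ _ _ (hBD y hy)]
      simp
  obtain ⟨φ, hφ, hφe⟩ := hl.extend_finite_dimension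
  refine ⟨φ, by simpa using hφ, ?_, ?_⟩
  · intro x hx
    rw [← hφe (Or.inr hx), Set.piecewise_eq_of_notMem _ _ _ (hBD x hx)]
  · intro x hx
    have : φ =ᶠ[nhds x] fun y => A y := by
      filter_upwards [Metric.isOpen_ball.mem_nhds hx] with y hy
      rw [← hφe (Or.inl hy), Set.piecewise_eq_of_mem _ _ _ hy]
    rw [this.fderiv_eq]
    exact A.fderiv

lemma aux_mod {N d m : ℕ} (hN : 0 < N) (p C : ℝ) (hp : 1 < p) (hC : 0 < C)
    (g : EuclideanSpace ℝ (Fin m) →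
      (EuclideanSpace ℝ (Fin N) →L[ℝ] EuclideanSpace ℝ (Fin d)) → ℝ)
    (hg : ConvexQuasiconvex N d m g) (h0 : ∀ b ξ, 0 ≤ g b ξ)
    (hub : ∀ b ξ, g b ξ ≤ C * (1 + ‖b‖ ^ p + ‖ξ‖)) : AuxMod N d m p C g := by
  classical
  intro b ξ b' ξ' δ hδ hδ1 hb hξ
  have : Nonempty (Fin N) := ⟨⟨0, hN⟩⟩
  obtain ⟨φ, hφ, hφ0, hφA⟩ := aux_test (ξ' - ξ) δ hδ hδ1 hξ
  set K := lipschitzExtensionConstant (EuclideanSpace ℝ (Fin d)) with hK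
  set B := Metric.ball (0 : EuclideanSpace ℝ (Fin N)) (1 - δ) with hB
  set D := Metric.ball (0 : EuclideanSpace ℝ (Fin N)) 1 with hD
  have hBD : B ⊆ D := Metric.ball_subset_ball (by linarith)
  have hBm : MeasurableSet B := Metric.isOpen_ball.measurableSet
  have hDf : volume D ≠ ⊤ := measure_ball_lt_top.ne
  set v := (volume : Measure (EuclideanSpace ℝ (Fin N))).real D with hv
  have hvpos : 0 < v := ENNReal.toReal_pos (Metric.measure_ball_pos _ _ one_pos).ne' hDf
  set q := (1 - δ) ^ N with hq
  have hBv : (volume : Measure (EuclideanSpace ℝ (Fin N))).real B = q * v := by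
    rw [hB, measureReal_def, Measure.addHaar_ball _ _ (by linarith : (0 : ℝ) ≤ 1 - δ)]
    rw [ENNReal.toReal_mul, ENNReal.toReal_ofReal (by positivity [show (0 : ℝ) ≤ 1 - δ by linarith])]
    simp [hq, hv, measureReal_def, hD]
  have hq0 : 0 ≤ q := pow_nonneg (by linarith) _
  have hq1 : q ≤ 1 - δ := by
    rw [hq]; exact pow_le_of_le_one (by linarith) (by linarith) hN.ne'
  have hq2 : 1 - q ≤ N * δ := by
    have := one_add_mul_le_pow (a := -δ) (by linarith) N
    rw [hq, sub_eq_add_neg 1 δ]; linarith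
  set c := q / (1 - q) with hc
  have hqp : 0 < 1 - q := by linarith
  have hc0 : 0 ≤ c := div_nonneg hq0 hqp.le
  have hcδ : c * δ ≤ 1 := by
    rw [hc, div_mul_eq_mul_div, div_le_one hqp]; nlinarith
  set w := b' - b with hw
  set η : EuclideanSpace ℝ (Fin N) → EuclideanSpace ℝ (Fin m) :=
    B.piecewise (fun _ => w) (fun _ => -(c • w)) with hη
  have hηm : Measurable η := measurable_const.piecewise hBm measurable_const
  have hη1 : ∀ x, ‖η x‖ ≤ 1 := by
    intro x
    by_cases hx : x ∈ B
    · rw [hη, Set.piecewise_eq_of_mem _ _ _ hx]; linarith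
    · rw [hη, Set.piecewise_eq_of_notMem _ _ _ hx, norm_neg, norm_smul, Real.norm_of_nonneg hc0]
      nlinarith
  have hηint : ∫ x in D, η x = 0 := by
    rw [hη, aux_setIntegral_piecewise _ B D hBD hBm hDf, hBv, smul_neg, smul_smul, ← sub_eq_add_neg,
      ← sub_smul]
    have : q * v - (v - q * v) * c = 0 := by rw [hc]; field_simp; ring
    rw [← hv, this, zero_smul]
  have h := hg b ξ D Metric.isOpen_ball Metric.isBounded_ball ⟨0, by simp [hD]⟩ η hηm ⟨1, hη1⟩ hηint
    φ K hφ hφ0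
  set M := C * (1 + (‖b‖ + 1) ^ p + (‖ξ‖ + K)) with hM
  have hM0 : 0 ≤ M := by positivity
  have : IsFiniteMeasure ((volume : Measure (EuclideanSpace ℝ (Fin N))).restrict D) :=
    ⟨by simpa using lt_top_iff_ne_top.2 hDf⟩
  have hmono : ∫ x in D, g (b + η x) (ξ + fderiv ℝ φ x) ≤
      ∫ x in D, B.piecewise (fun _ => g b' ξ') (fun _ => M) x := by
    apply integral_mono_of_nonneg
    · exact Eventually.of_forall fun x => h0 _ _
    · exact Integrable.piecewise hBm (integrable_const _).integrableOn (integrable_const _).integrableOn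
    · refine Eventually.of_forall fun x => ?_
      by_cases hx : x ∈ B
      · simp only [hη, Set.piecewise_eq_of_mem _ _ _ hx, hφA x hx, hw]
        simp
      · simp only [Set.piecewise_eq_of_notMem _ _ _ hx]
        refine (hub _ _).trans ?_
        have e1 : ‖b + η x‖ ^ p ≤ (‖b‖ + 1) ^ p :=
          Real.rpow_le_rpow (norm_nonneg _) ((norm_add_le _ _).trans (by linarith [hη1 x]))
            (by linarith)
        have e2 : ‖ξ + fderiv ℝ φ x‖ ≤ ‖ξ‖ + K :=
          (norm_add_le _ _).trans (by linarith [norm_fderiv_le_of_lipschitz ℝ hφ (x₀ := x)])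
        rw [hM]
        exact mul_le_mul_of_nonneg_left (by linarith) hC.le
  rw [aux_setIntegral_piecewise _ B D hBD hBm hDf, hBv, ← hv] at hmono
  have h2 : g b ξ ≤ v⁻¹ * ((q * v) • g b' ξ' + (v - q * v) • M) :=
    h.trans (mul_le_mul_of_nonneg_left hmono (inv_nonneg.2 hvpos.le))
  have h3 : v⁻¹ * ((q * v) • g b' ξ' + (v - q * v) • M) = q * g b' ξ' + (1 - q) * M := by
    simp only [smul_eq_mul]; field_simp
  rw [h3] at h2
  have h4 := h0 b' ξ'
  nlinarith [mul_le_mul_of_nonneg_right hq2 hM0]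

lemma aux_cont {N d m : ℕ} (p C : ℝ) (hp : 1 < p) (hC : 0 < C)
    (g : EuclideanSpace ℝ (Fin m) →
      (EuclideanSpace ℝ (Fin N) →L[ℝ] EuclideanSpace ℝ (Fin d)) → ℝ)
    (hg : AuxMod N d m p C g) : Continuous (fun z : EuclideanSpace ℝ (Fin m) ×
      (EuclideanSpace ℝ (Fin N) →L[ℝ] EuclideanSpace ℝ (Fin d)) => g z.1 z.2) := by
  rw [Metric.continuous_iff]
  rintro ⟨b, ξ⟩ ε hε
  set K := lipschitzExtensionConstant (EuclideanSpace ℝ (Fin d)) with hK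
  set M := N * (C * (1 + (‖b‖ + 2) ^ p + (‖ξ‖ + 1 + K))) with hM
  have hM0 : 0 ≤ M := by positivity
  set δ := min (1 / 2) (ε / (2 * (M + 1))) with hδ
  have hδ0 : 0 < δ := by positivity
  have hδ1 : δ ≤ 1 / 2 := min_le_left _ _
  have hδ2 : δ * M < ε := by
    have : δ ≤ ε / (2 * (M + 1)) := min_le_right _ _
    rw [le_div_iff₀ (by positivity)] at this
    nlinarith
  refine ⟨δ, hδ0, ?_⟩
  rintro ⟨b', ξ'⟩ hd
  rw [Prod.dist_eq, max_lt_iff] at hd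
  obtain ⟨hb, hξ⟩ := hd
  simp only [dist_eq_norm] at hb hξ
  have k1 := hg b ξ b' ξ' δ hδ0 hδ1 hb.le hξ.le
  have k2 := hg b' ξ' b ξ δ hδ0 hδ1 (by rw [norm_sub_rev]; exact hb.le)
    (by rw [norm_sub_rev]; exact hξ.le)
  have bd : ∀ s r : ℝ, 0 ≤ s → s ≤ ‖b‖ + 1 → r ≤ ‖ξ‖ + 1 →
      N * δ * (C * (1 + (s + 1) ^ p + (r + K))) ≤ δ * M := by
    intro s r hs0 hs hr
    have e1 : (s + 1) ^ p ≤ (‖b‖ + 2) ^ p :=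
      Real.rpow_le_rpow (by linarith) (by linarith) (by linarith)
    calc N * δ * (C * (1 + (s + 1) ^ p + (r + K)))
        ≤ N * δ * (C * (1 + (‖b‖ + 2) ^ p + (‖ξ‖ + 1 + K))) := by gcongr
      _ = δ * M := by rw [hM]; ring
  have nb : ‖b'‖ ≤ ‖b‖ + 1 := by linarith [norm_sub_norm_le b' b]
  have nξ : ‖ξ'‖ ≤ ‖ξ‖ + 1 := by linarith [norm_sub_norm_le ξ' ξ]
  have l1 := bd ‖b‖ ‖ξ‖ (norm_nonneg _) (by linarith) (by linarith)
  have l2 := bd ‖b'‖ ‖ξ'‖ (norm_nonneg _) nb nξ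
  rw [Real.dist_eq, abs_lt]
  constructor <;> simp only <;> linarith

lemma aux_meas {N d m : ℕ} (p C : ℝ) (hp : 1 < p) (hC : 0 < C)
    (g : EuclideanSpace ℝ (Fin m) →
      (EuclideanSpace ℝ (Fin N) →L[ℝ] EuclideanSpace ℝ (Fin d)) → ℝ)
    (hg : 0 < N → AuxMod N d m p C g) (b : EuclideanSpace ℝ (Fin m))
    (ξ : EuclideanSpace ℝ (Fin N) →L[ℝ] EuclideanSpace ℝ (Fin d))
    (η : EuclideanSpace ℝ (Fin N) → EuclideanSpace ℝ (Fin m)) (hη : Measurable η)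
    (φ : EuclideanSpace ℝ (Fin N) → EuclideanSpace ℝ (Fin d)) :
    Measurable (fun x => g (b + η x) (ξ + fderiv ℝ φ x)) := by
  rcases Nat.eq_zero_or_pos N with h | h
  · subst h
    exact Subsingleton.measurable
  · have hc := aux_cont p C hp hC g (hg h)
    exact hc.measurable.comp ((measurable_const.add hη).prodMk
      (measurable_const.add (measurable_fderiv ℝ φ)))

/-- if `f(x,u,·,·)` is convex-quasiconvex and satisfies the growth
condition `(H1)_p`, then its (p,1)-recession function is convex-quasiconvex in `(b,ξ)`
for each fixed `(x,u)`. -/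
theorem recession_convexQuasiconvex {N d m : ℕ} (p : ℝ) (hp : 1 < p)
    (Ω : Set (EuclideanSpace ℝ (Fin N))) (hΩo : IsOpen Ω)
    (hΩb : Bornology.IsBounded Ω)
    (f : EuclideanSpace ℝ (Fin N) → EuclideanSpace ℝ (Fin d) →
      EuclideanSpace ℝ (Fin m) →
      (EuclideanSpace ℝ (Fin N) →L[ℝ] EuclideanSpace ℝ (Fin d)) → ℝ)
    (hf_nonneg : ∀ x u b ξ, 0 ≤ f x u b ξ)
    (H0 : ∀ x u, ConvexQuasiconvex N d m (f x u))
    (C : ℝ) (hC : 0 < C)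
    (H1lb : ∀ x u b ξ, (1 / C) * (‖b‖ ^ p + ‖ξ‖) - C ≤ f x u b ξ)
    (H1ub : ∀ x u b ξ, f x u b ξ ≤ C * (1 + ‖b‖ ^ p + ‖ξ‖)) :
    ∀ x u, ConvexQuasiconvex N d m (recP p f x u) := by

  intro x u
  set G : ℝ → EuclideanSpace ℝ (Fin m) →
      (EuclideanSpace ℝ (Fin N) →L[ℝ] EuclideanSpace ℝ (Fin d)) → ℝ :=
    fun t b ξ => f x u ((t ^ (1 / p)) • b) (t • ξ) / t with hG
  have hrec : ∀ b ξ, recP p f x u b ξ = limsup (fun t => G t b ξ) atTop := fun _ _ => rfl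
  have hGq : ∀ t, 1 ≤ t → ConvexQuasiconvex N d m (G t) := fun t ht =>
    aux_scale _ (H0 x u) _ t (by linarith)
  have hG0 : ∀ t, 1 ≤ t → ∀ b ξ, 0 ≤ G t b ξ := fun t ht b ξ =>
    div_nonneg (hf_nonneg _ _ _ _) (by linarith)
  have hGub : ∀ t, 1 ≤ t → ∀ b ξ, G t b ξ ≤ C * (1 + ‖b‖ ^ p + ‖ξ‖) := by
    intro t ht b ξ
    have ht0 : 0 < t := by linarith
    simp only [hG]
    rw [div_le_iff₀ ht0]
    refine (H1ub _ _ _ _).trans ?_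
    rw [norm_smul, norm_smul, Real.norm_of_nonneg (by positivity), Real.norm_of_nonneg ht0.le,
      Real.mul_rpow (by positivity) (norm_nonneg _), ← Real.rpow_mul ht0.le,
      one_div_mul_cancel (by linarith), Real.rpow_one, mul_assoc]
    refine mul_le_mul_of_nonneg_left ?_ hC.le
    linarith
  have hev : ∀ᶠ t : ℝ in atTop, 1 ≤ t := eventually_ge_atTop 1
  have hbdd : ∀ b ξ, IsBoundedUnder (· ≤ ·) atTop (fun t => G t b ξ) := fun b ξ =>
    isBoundedUnder_of_eventually_le (hev.mono fun t ht => hGub t ht b ξ)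
  have hcob : ∀ b ξ, IsCoboundedUnder (· ≤ ·) atTop (fun t => G t b ξ) := fun b ξ =>
    (isBoundedUnder_of_eventually_ge (hev.mono fun t ht => hG0 t ht b ξ)).isCoboundedUnder_le
  have hr0 : ∀ b ξ, 0 ≤ recP p f x u b ξ := fun b ξ => by
    rw [hrec]
    exact le_limsup_of_frequently_le (hev.mono fun t ht => hG0 t ht b ξ).frequently (hbdd b ξ)
  have hrub : ∀ b ξ, recP p f x u b ξ ≤ C * (1 + ‖b‖ ^ p + ‖ξ‖) := fun b ξ => by
    rw [hrec]
    exact limsup_le_of_le (hcob b ξ) (hev.mono fun t ht => hGub t ht b ξ)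
  have hGmod : ∀ t, 1 ≤ t → 0 < N → AuxMod N d m p C (G t) := fun t ht hN =>
    aux_mod hN p C hp hC _ (hGq t ht) (hG0 t ht) (hGub t ht)
  have hrmod : 0 < N → AuxMod N d m p C (recP p f x u) := by
    intro hN b ξ b' ξ' δ h1 h2 h3 h4
    refine le_of_forall_pos_lt_add fun ε hε => ?_
    have e1 : ∀ᶠ t in atTop, G t b' ξ' < recP p f x u b' ξ' + ε / 2 :=
      eventually_lt_of_limsup_lt (by rw [← hrec]; linarith) (hbdd b' ξ')
    rw [hrec b ξ]
    refine lt_of_le_of_lt (limsup_le_of_le (hcob b ξ) (a := recP p f x u b' ξ' + ε / 2 +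
      N * δ * (C * (1 + (‖b‖ + 1) ^ p +
      (‖ξ‖ + lipschitzExtensionConstant (EuclideanSpace ℝ (Fin d)))))) ?_) (by linarith)
    filter_upwards [e1, hev] with t ht1 ht
    have := hGmod t ht hN b ξ b' ξ' δ h1 h2 h3 h4
    linarith
  intro b ξ D hD hDb hDn η hη hηb hη0 φ L hφ hφ0
  obtain ⟨M, hM⟩ := hηb
  have : IsFiniteMeasure ((volume : Measure (EuclideanSpace ℝ (Fin N))).restrict D) :=
    ⟨by simpa using hDb.measure_lt_top⟩
  set S := C * (1 + (‖b‖ + M) ^ p + (‖ξ‖ + L)) with hS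
  have hSb : ∀ y, C * (1 + ‖b + η y‖ ^ p + ‖ξ + fderiv ℝ φ y‖) ≤ S := by
    intro y
    have e1 : ‖b + η y‖ ^ p ≤ (‖b‖ + M) ^ p :=
      Real.rpow_le_rpow (norm_nonneg _) ((norm_add_le _ _).trans (by linarith [hM y]))
        (by linarith)
    have e2 : ‖ξ + fderiv ℝ φ y‖ ≤ ‖ξ‖ + L :=
      (norm_add_le _ _).trans (by linarith [norm_fderiv_le_of_lipschitz ℝ hφ (x₀ := y)])
    exact mul_le_mul_of_nonneg_left (by linarith) hC.le
  set r : EuclideanSpace ℝ (Fin N) → ℝ :=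
    fun y => recP p f x u (b + η y) (ξ + fderiv ℝ φ y) with hr
  have hrm : Measurable r := aux_meas p C hp hC _ hrmod b ξ η hη φ
  have hgm : ∀ t, 1 ≤ t → Measurable (fun y => G t (b + η y) (ξ + fderiv ℝ φ y)) := fun t ht =>
    aux_meas p C hp hC _ (hGmod t ht) b ξ η hη φ
  have hri : Integrable r (volume.restrict D) :=
    Integrable.of_bound hrm.aestronglyMeasurable S (Eventually.of_forall fun y => by
      rw [Real.norm_of_nonneg (hr0 _ _)]; exact (hrub _ _).trans (hSb y))
  set F : ℝ → EuclideanSpace ℝ (Fin N) → ℝ :=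
    fun t y => max (G t (b + η y) (ξ + fderiv ℝ φ y) - r y) 0 with hF
  have hFm : ∀ t, 1 ≤ t → Measurable (F t) := fun t ht =>
    ((hgm t ht).sub hrm).max measurable_const
  have hFb : ∀ t, 1 ≤ t → ∀ y, ‖F t y‖ ≤ S := by
    intro t ht y
    rw [Real.norm_of_nonneg (le_max_right _ _)]
    have a1 := (hGub t ht (b + η y) (ξ + fderiv ℝ φ y)).trans (hSb y)
    have a2 : 0 ≤ r y := hr0 _ _
    have a3 := (hG0 t ht (b + η y) (ξ + fderiv ℝ φ y))
    exact max_le (by linarith) (by linarith)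
  have hlim : Tendsto (fun t => ∫ y in D, F t y) atTop (nhds (∫ y in D, (0 : ℝ))) := by
    refine tendsto_integral_filter_of_dominated_convergence (fun _ => S) ?_ ?_ (integrable_const _) ?_
    · exact hev.mono fun t ht => (hFm t ht).aestronglyMeasurable
    · exact hev.mono fun t ht => Eventually.of_forall (hFb t ht)
    · refine Eventually.of_forall fun y => ?_
      rw [Metric.tendsto_nhds]
      intro ε hε
      have e1 : ∀ᶠ t in atTop, G t (b + η y) (ξ + fderiv ℝ φ y) < r y + ε :=
        eventually_lt_of_limsup_lt (by rw [← hrec]; simp only [hr]; linarith) (hbdd _ _)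
      filter_upwards [e1] with t ht
      rw [dist_zero_right, Real.norm_of_nonneg (le_max_right _ _)]
      exact max_lt (by linarith) hε
  rw [integral_zero] at hlim
  have hlim2 : Tendsto (fun t => (volume D).toReal⁻¹ * (∫ y in D, r y) +
      (volume D).toReal⁻¹ * ∫ y in D, F t y) atTop
      (nhds ((volume D).toReal⁻¹ * (∫ y in D, r y))) := by
    simpa using (hlim.const_mul ((volume D).toReal⁻¹)).const_add
      ((volume D).toReal⁻¹ * (∫ y in D, r y))
  rw [hrec b ξ, ← hlim2.limsup_eq]
  refine limsup_le_limsup ?_ (hcob b ξ) hlim2.isBoundedUnder_le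
  filter_upwards [hev] with t ht
  refine (hGq t ht b ξ D hD hDb hDn η hη ⟨M, hM⟩ hη0 φ L hφ hφ0).trans ?_
  rw [← mul_add]
  refine mul_le_mul_of_nonneg_left ?_ (by positivity)
  have hFi : Integrable (F t) (volume.restrict D) :=
    Integrable.of_bound (hFm t ht).aestronglyMeasurable S (Eventually.of_forall (hFb t ht))
  rw [← integral_add hri hFi]
  refine integral_mono_of_nonneg (Eventually.of_forall fun y => hG0 t ht _ _) (hri.add hFi)
    (Eventually.of_forall fun y => ?_)
  have := le_max_left (G t (b + η y) (ξ + fderiv ℝ φ y) - r y) 0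
  simp only [hF]
  linarith
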